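/- Let X, Y be compact metric spaces, f : X → X, g : Y → Y continuous maps, C a chain component of f, D ∈ 𝒟(C), C' a chain component of g, and let h : (C, f|_C) → (C', g|_{C'}) be a topological conjugacy (so h(D) ∈ 𝒟(C')). Let ℱ, 𝒢 be full Furstenberg families, n ≥ 2 and δ > 0. If g has the s-limit shadowing property and V^s(D) is dense (ℱ,𝒢)-n-δ-chaotic for f, then there exists δ' > 0 such that V^s(h(D)) is dense (ℱ,𝒢)-n-δ'-chaotic for g. -/

import Mathlib

open Filter Metric Set Topology

section Defs

variable {X : Type*} [MetricSpace X]

/-- A δ-chain of `f` of length `k` (with `k ≥ 1`) within the set `C`, from `x` to `y`. -/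
def ChainIn (f : X → X) (C : Set X) (δ : ℝ) (k : ℕ) (x y : X) : Prop :=
  1 ≤ k ∧ ∃ c : ℕ → X, c 0 = x ∧ c k = y ∧ (∀ i ≤ k, c i ∈ C) ∧
    ∀ i < k, dist (f (c i)) (c (i + 1)) ≤ δ

/-- `x → y` : for every `δ > 0` there is a `δ`-chain of `f` from `x` to `y`. -/
def ChainReach (f : X → X) (x y : X) : Prop :=
  ∀ δ > 0, ∃ k, ChainIn f Set.univ δ k x y

/-- `x` is chain recurrent for `f`. -/
def ChainRecurrent (f : X → X) (x : X) : Prop := ChainReach f x x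

/-- `C` is a chain component of `f`: an equivalence class of the relation `↔`
on the set of chain recurrent points. -/
def IsChainComponent (f : X → X) (C : Set X) : Prop :=
  ∃ x, ChainRecurrent f x ∧
    C = {y | ChainRecurrent f y ∧ ChainReach f x y ∧ ChainReach f y x}

/-- The set of lengths of δ-cycles of `f` restricted to `C`. -/
def cycleLengths (f : X → X) (C : Set X) (δ : ℝ) : Set ℕ :=
  {k | ∃ x ∈ C, ChainIn f C δ k x x}

/-- The greatest common divisor of a set of natural numbers
(the greatest natural number dividing every element). -/
noncomputable def setGcd (S : Set ℕ) : ℕ := sSup {d | ∀ k ∈ S, d ∣ k}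

/-- `x ∼_{C,δ} y` : there is a δ-chain of `f|_C` from `x` to `y` whose length is
divisible by `m(C,δ)`, the gcd of the lengths of all δ-cycles of `f|_C`. -/
def SimCd (f : X → X) (C : Set X) (δ : ℝ) (x y : X) : Prop :=
  ∃ k, setGcd (cycleLengths f C δ) ∣ k ∧ ChainIn f C δ k x y

/-- `x ∼_C y` : `x ∼_{C,δ} y` for all `δ > 0`. -/
def SimC (f : X → X) (C : Set X) (x y : X) : Prop :=
  ∀ δ > 0, SimCd f C δ x y

/-- `𝒟(C,δ)` : the set of equivalence classes of `∼_{C,δ}`. -/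
def DClassesd (f : X → X) (C : Set X) (δ : ℝ) : Set (Set X) :=
  {D | ∃ x ∈ C, D = {y ∈ C | SimCd f C δ x y}}

/-- `𝒟(C)` : the set of equivalence classes of `∼_C`. -/
def DClasses (f : X → X) (C : Set X) : Set (Set X) :=
  {D | ∃ x ∈ C, D = {y ∈ C | SimC f C x y}}

/-- `W^s(C) = {x : lim_{i→∞} d(f^i(x), C) = 0}`. -/
def wStable (f : X → X) (C : Set X) : Set X :=
  {x | Tendsto (fun i => infDist (f^[i] x) C) atTop (nhds 0)}

/-- `V^s(D) = ⋂_{δ>0} {x ∈ W^s(C) : lim_{i→∞} d(f^i(x), f^i(D_δ)) = 0}`, where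
`D_δ` is the unique element of `𝒟(C,δ)` containing `D`. -/
def vStable (f : X → X) (C D : Set X) : Set X :=
  {x | x ∈ wStable f C ∧ ∀ δ > 0, ∀ Dd ∈ DClassesd f C δ, D ⊆ Dd →
    Tendsto (fun i => infDist (f^[i] x) (f^[i] '' Dd)) atTop (nhds 0)}

/-- The s-limit shadowing property. -/
def SLimitShadowing (f : X → X) : Prop :=
  ∀ ε > 0, ∃ δ > 0, ∀ x : ℕ → X,
    (∀ i, dist (f (x i)) (x (i + 1)) ≤ δ) →
    Tendsto (fun i => dist (f (x i)) (x (i + 1))) atTop (nhds 0) →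
    ∃ z : X, (∀ i, dist (f^[i] z) (x i) ≤ ε) ∧
      Tendsto (fun i => dist (f^[i] z) (x i)) atTop (nhds 0)

/-- The limit shadowing property. -/
def LimitShadowing (f : X → X) : Prop :=
  ∀ x : ℕ → X, Tendsto (fun i => dist (f (x i)) (x (i + 1))) atTop (nhds 0) →
    ∃ z : X, Tendsto (fun i => dist (f^[i] z) (x i)) atTop (nhds 0)

/-- The (plain) shadowing property. -/
def ShadowingProperty (f : X → X) : Prop :=
  ∀ ε > 0, ∃ δ > 0, ∀ x : ℕ → X, (∀ i, dist (f (x i)) (x (i + 1)) ≤ δ) →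
    ∃ z : X, ∀ i, dist (f^[i] z) (x i) ≤ ε

/-- A Furstenberg family: hereditary upward and proper. -/
def FurstenbergFamily (F : Set (Set ℕ)) : Prop :=
  (∀ A B : Set ℕ, A ∈ F → A ⊆ B → B ∈ F) ∧ F.Nonempty ∧ F ≠ Set.univ

/-- A full Furstenberg family. -/
def FullFamily (F : Set (Set ℕ)) : Prop :=
  ∀ A ∈ F, ∀ n : ℕ, {i ∈ A | n ≤ i} ∈ F

/-- A translation invariant Furstenberg family. -/
def TranslationInvariantFamily (F : Set (Set ℕ)) : Prop :=
  ∀ A ∈ F, ∀ n : ℕ, ((fun i => i + n) '' A ∈ F ∧ {i | i + n ∈ A} ∈ F)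

/-- `S_f(x₁,…,xₙ; r) = {i : min_{j<k} d(fⁱ(x_j), fⁱ(x_k)) > r}`. -/
def Sset (f : X → X) {n : ℕ} (x : Fin n → X) (r : ℝ) : Set ℕ :=
  {i | ∀ j k : Fin n, j < k → r < dist (f^[i] (x j)) (f^[i] (x k))}

/-- `T_f(x₁,…,xₙ; r) = {i : max_{j<k} d(fⁱ(x_j), fⁱ(x_k)) < r}`. -/
def Tset (f : X → X) {n : ℕ} (x : Fin n → X) (r : ℝ) : Set ℕ :=
  {i | ∀ j k : Fin n, j < k → dist (f^[i] (x j)) (f^[i] (x k)) < r}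

/-- `(x₁,…,xₙ)` is an `(ℱ,𝒢)`-δ-scrambled n-tuple for `f`. -/
def Scrambled (f : X → X) (F G : Set (Set ℕ)) (δ : ℝ) {n : ℕ} (x : Fin n → X) : Prop :=
  Sset f x δ ∈ F ∧ ∀ ε > 0, Tset f x ε ∈ G

/-- `Y` is dense `(ℱ,𝒢)`-n-δ-chaotic for `f`: the `(ℱ,𝒢)`-δ-scrambled n-tuples in `Yⁿ`
form a dense subset of `Yⁿ`. -/
def DenseChaotic (f : X → X) (F G : Set (Set ℕ)) (n : ℕ) (δ : ℝ) (Y : Set X) : Prop :=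
  {x : Fin n → X | ∀ j, x j ∈ Y} ⊆
    closure {x : Fin n → X | (∀ j, x j ∈ Y) ∧ Scrambled f F G δ x}

/-- `S` is a residual subset of the subspace `T`: it contains a countable intersection of
dense open subsets of `T`. -/
def ResidualIn {α : Type*} [TopologicalSpace α] (T S : Set α) : Prop :=
  ∃ U : ℕ → Set α, (∀ i, IsOpen (U i)) ∧ (∀ i, T ⊆ closure (U i ∩ T)) ∧
    (⋂ i, U i) ∩ T ⊆ S

/-- `Y` is generic `(ℱ,𝒢)`-n-δ-chaotic for `f`: the `(ℱ,𝒢)`-δ-scrambled n-tuples in `Yⁿ`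
form a residual subset of `Yⁿ`. -/
def GenericChaotic (f : X → X) (F G : Set (Set ℕ)) (n : ℕ) (δ : ℝ) (Y : Set X) : Prop :=
  ResidualIn {x : Fin n → X | ∀ j, x j ∈ Y}
    {x : Fin n → X | (∀ j, x j ∈ Y) ∧ Scrambled f F G δ x}

/-- A Furstenberg family `F` is compatible with `(Z, g)`. -/
def CompatibleFamily {Z : Type*} [TopologicalSpace Z] (F : Set (Set ℕ)) (g : Z → Z) : Prop :=
  ∀ U : Set Z, IsOpen U → IsGδ {z | {i | g^[i] z ∈ U} ∈ F}

end Defs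

section Chains

variable {X : Type*} [MetricSpace X] {f : X → X} {C : Set X} {δ δ' : ℝ} {k l : ℕ} {x y z : X}

lemma ChainIn.mono {C' : Set X} (h : ChainIn f C δ k x y) (hC : C ⊆ C') (hδ : δ ≤ δ') :
    ChainIn f C' δ' k x y := by
  obtain ⟨hk, c, h0, h1, hc, hd⟩ := h
  exact ⟨hk, c, h0, h1, fun i hi => hC (hc i hi), fun i hi => (hd i hi).trans hδ⟩

lemma ChainIn.left_mem (h : ChainIn f C δ k x y) : x ∈ C := by
  obtain ⟨hk, c, h0, h1, hc, hd⟩ := h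
  exact h0 ▸ hc 0 (Nat.zero_le _)

lemma ChainIn.trans (h : ChainIn f C δ k x y) (h' : ChainIn f C δ l y z) :
    ChainIn f C δ (k + l) x z := by
  obtain ⟨hk, c, h0, h1, hc, hd⟩ := h
  obtain ⟨hl, c', h0', h1', hc', hd'⟩ := h'
  refine ⟨by omega, fun i => if i < k then c i else c' (i - k), ?_, ?_, ?_, ?_⟩
  · simp only [show 0 < k by omega, if_true, h0]
  · simp [h1']
  · intro i hi
    dsimp only
    split_ifs with hik
    · exact hc i hik.le
    · exact hc' _ (by omega)
  · intro i hi
    dsimp only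
    rcases lt_trichotomy (i + 1) k with h2 | h2 | h2
    · rw [if_pos (by omega), if_pos h2]
      exact hd i (by omega)
    · rw [if_pos (by omega), if_neg (by omega), h2, Nat.sub_self, h0', ← h1, ← h2]
      exact hd i (by omega)
    · rw [if_neg (by omega), if_neg (by omega), show i + 1 - k = (i - k) + 1 by omega]
      exact hd' _ (by omega)

lemma ChainIn.orbit (hmaps : MapsTo f C C) (hx : x ∈ C) (hk : 1 ≤ k) :
    ChainIn f C 0 k x (f^[k] x) :=
  ⟨hk, fun i => f^[i] x, rfl, rfl, fun i _ => hmaps.iterate i hx, fun i _ => by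
    simp [Function.iterate_succ_apply']⟩

lemma ChainIn.change_right (h : ChainIn f C δ k x y) (hz : z ∈ C) (hδ' : dist y z ≤ δ') :
    ChainIn f C (δ + δ') k x z := by
  obtain ⟨hk, c, h0, h1, hc, hd⟩ := h
  have hpos : 0 ≤ δ' := dist_nonneg.trans hδ'
  refine ⟨hk, Function.update c k z, ?_, by simp, ?_, ?_⟩
  · rw [Function.update_of_ne (by omega), h0]
  · intro i hi
    rcases eq_or_ne i k with rfl | hik
    · simpa
    · rw [Function.update_of_ne hik]
      exact hc i hi
  · intro i hi
    rw [Function.update_of_ne hi.ne]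
    rcases eq_or_ne (i + 1) k with hik | hik
    · rw [hik, Function.update_self]
      have := hd i hi
      rw [hik, h1] at this
      linarith [dist_triangle (f (c i)) y z]
    · rw [Function.update_of_ne hik]
      linarith [hd i hi]

lemma ChainIn.change_left (h : ChainIn f C δ k x y) (hz : z ∈ C) (hδ' : dist (f z) (f x) ≤ δ') :
    ChainIn f C (δ + δ') k z y := by
  obtain ⟨hk, c, h0, h1, hc, hd⟩ := h
  have hpos : 0 ≤ δ' := dist_nonneg.trans hδ'
  refine ⟨hk, Function.update c 0 z, by simp, ?_, ?_, ?_⟩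
  · rw [Function.update_of_ne (by omega), h1]
  · intro i hi
    rcases eq_or_ne i 0 with rfl | hik
    · simpa
    · rw [Function.update_of_ne hik]
      exact hc i hi
  · intro i hi
    rw [Function.update_of_ne (Nat.succ_ne_zero i)]
    rcases eq_or_ne i 0 with rfl | hik
    · rw [Function.update_self]
      have := hd 0 hi
      rw [h0] at this
      linarith [dist_triangle (f z) (f x) (c (0 + 1))]
    · rw [Function.update_of_ne hik]
      linarith [hd i hi]

lemma ChainIn.exists_split (h : ChainIn f C δ (k + l) x y) (hk : 1 ≤ k) (hl : 1 ≤ l) :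
    ∃ z, ChainIn f C δ k x z ∧ ChainIn f C δ l z y := by
  obtain ⟨-, c, h0, h1, hc, hd⟩ := h
  refine ⟨c k, ⟨hk, c, h0, rfl, fun i hi => hc i (by omega), fun i hi => hd i (by omega)⟩,
    ⟨hl, fun i => c (k + i), rfl, h1, fun i hi => hc _ (by omega), fun i hi => ?_⟩⟩
  exact hd (k + i) (by omega)

lemma ChainReach.trans (h : ChainReach f x y) (h' : ChainReach f y z) : ChainReach f x z := by
  intro δ hδ
  obtain ⟨k, hk⟩ := h δ hδ
  obtain ⟨l, hl⟩ := h' δ hδ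
  exact ⟨k + l, hk.trans hl⟩

lemma chainReach_of_approx_right
    (h : ∀ ε > 0, ∃ y k, dist y z ≤ ε ∧ ChainIn f univ ε k x y) : ChainReach f x z := by
  intro δ hδ
  obtain ⟨y, k, hy, hk⟩ := h (δ / 2) (by positivity)
  exact ⟨k, (hk.change_right (mem_univ z) hy).mono le_rfl (by linarith)⟩

lemma exists_dist_map_le_of_continuous [CompactSpace X] (hf : Continuous f) {ε : ℝ} (hε : 0 < ε) :
    ∃ ρ > 0, ∀ a b, dist a b ≤ ρ → dist (f a) (f b) ≤ ε := by
  obtain ⟨ρ, hρ, H⟩ := Metric.uniformContinuous_iff.1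
    (CompactSpace.uniformContinuous_of_continuous hf) ε hε
  exact ⟨ρ / 2, by positivity, fun a b hab => (H (by linarith)).le⟩

lemma chainReach_of_approx_left [CompactSpace X] (hf : Continuous f)
    (h : ∀ ε > 0, ∃ x k, dist x z ≤ ε ∧ ChainIn f univ ε k x y) : ChainReach f z y := by
  intro δ hδ
  obtain ⟨ρ, hρ, H⟩ := exists_dist_map_le_of_continuous hf (half_pos hδ)
  obtain ⟨x, k, hx, hk⟩ := h (min ρ (δ / 2)) (by positivity)
  refine ⟨k, (hk.change_left (mem_univ z) (H z x ?_)).mono le_rfl ?_⟩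
  · rw [dist_comm]
    exact hx.trans (min_le_left _ _)
  · linarith [min_le_right ρ (δ / 2)]

lemma chainReach_map_left [CompactSpace X] (hf : Continuous f) (h : ChainReach f x x) :
    ChainReach f (f x) x := by
  intro δ hδ
  obtain ⟨ρ, hρ, H⟩ := exists_dist_map_le_of_continuous hf (half_pos hδ)
  obtain ⟨k, hk⟩ := h (min ρ (δ / 2)) (by positivity)
  have hk1 : 1 ≤ k := hk.1
  have h2 := hk.trans hk
  obtain ⟨z, h1, h2⟩ := ChainIn.exists_split (k := 1) (l := k + k - 1)
    (by rwa [show 1 + (k + k - 1) = k + k by omega]) le_rfl (by omega)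
  have hz : dist (f x) z ≤ min ρ (δ / 2) := by
    obtain ⟨-, c, c0, c1, -, hd⟩ := h1
    simpa [c0, c1] using hd 0 one_pos
  refine ⟨k + k - 1, (h2.change_left (mem_univ (f x)) (H (f x) z ?_)).mono le_rfl ?_⟩
  · exact hz.trans (min_le_left _ _)
  · linarith [min_le_right ρ (δ / 2)]

end Chains

section ChainComponents

variable {X : Type*} [MetricSpace X] {f : X → X} {C : Set X}

lemma IsChainComponent.nonempty (hC : IsChainComponent f C) : C.Nonempty := by
  obtain ⟨x, hx, rfl⟩ := hC
  exact ⟨x, hx, hx, hx⟩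

lemma IsChainComponent.mem_iff (hC : IsChainComponent f C) {a b : X} (ha : a ∈ C) :
    b ∈ C ↔ ChainReach f a b ∧ ChainReach f b a := by
  obtain ⟨x, hx, rfl⟩ := hC
  obtain ⟨-, hxa, hax⟩ := ha
  exact ⟨fun ⟨_, hxb, hbx⟩ => ⟨hax.trans hxb, hbx.trans hxa⟩,
    fun ⟨hab, hba⟩ => ⟨hba.trans hab, hxa.trans hab, hba.trans hax⟩⟩

lemma IsChainComponent.mapsTo [CompactSpace X] (hC : IsChainComponent f C) (hf : Continuous f) :
    MapsTo f C C := by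
  intro x hx
  refine (hC.mem_iff hx).2 ⟨fun δ hδ => ⟨1, ?_⟩, chainReach_map_left hf ((hC.mem_iff hx).1 hx).1⟩
  exact (ChainIn.orbit (mapsTo_univ f univ) (mem_univ x) le_rfl).mono le_rfl hδ.le

lemma IsChainComponent.isClosed [CompactSpace X] (hC : IsChainComponent f C)
    (hf : Continuous f) : IsClosed C := by
  obtain ⟨a, ha⟩ := hC.nonempty
  refine isClosed_of_closure_subset fun z hz => (hC.mem_iff ha).2 ⟨?_, ?_⟩
  · refine chainReach_of_approx_right fun ε hε => ?_
    obtain ⟨y, hy, hyz⟩ := Metric.mem_closure_iff.1 hz ε hε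
    obtain ⟨k, hk⟩ := ((hC.mem_iff ha).1 hy).1 ε hε
    exact ⟨y, k, by rw [dist_comm]; exact hyz.le, hk⟩
  · refine chainReach_of_approx_left hf fun ε hε => ?_
    obtain ⟨y, hy, hyz⟩ := Metric.mem_closure_iff.1 hz ε hε
    obtain ⟨k, hk⟩ := ((hC.mem_iff ha).1 hy).2 ε hε
    exact ⟨y, k, by rw [dist_comm]; exact hyz.le, hk⟩

/-- Sufficiently fine chains between two points of a chain component stay close to it. -/
lemma IsChainComponent.exists_chain_near [CompactSpace X] (hC : IsChainComponent f C)
    (hf : Continuous f) {a b : X} (ha : a ∈ C) (hb : b ∈ C) {ε : ℝ} (hε : 0 < ε) :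
    ∃ η > 0, ∀ (k : ℕ) (c : ℕ → X), c 0 = a → c k = b →
      (∀ i < k, dist (f (c i)) (c (i + 1)) ≤ η) → ∀ i ≤ k, infDist (c i) C < ε := by
  by_contra! H
  choose k c h0 h1 hd i hi hfar using fun n : ℕ => H (1 / ((n : ℝ) + 1)) (by positivity)
  obtain ⟨z, φ, hφ, hz⟩ := CompactSpace.tendsto_subseq (fun n => c n (i n))
  have hzfar : ε ≤ infDist z C :=
    ge_of_tendsto' (((continuous_infDist_pt C).tendsto z).comp hz) fun n => hfar (φ n)
  have happrox : ∀ r > 0, ∃ n, dist (c n (i n)) z ≤ r ∧ 1 / ((n : ℝ) + 1) ≤ r := by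
    intro r hr
    have e1 := (Metric.tendsto_nhds.1 hz r hr)
    have e2 := ((tendsto_one_div_add_atTop_nhds_zero_nat (𝕜 := ℝ)).comp
      hφ.tendsto_atTop).eventually (gt_mem_nhds hr)
    obtain ⟨n, hn1, hn2⟩ := (e1.and e2).exists
    exact ⟨φ n, hn1.le, hn2.le⟩
  have hi0 : ∀ n, 1 ≤ i n := by
    intro n
    by_contra hcon
    have := hfar n
    rw [show i n = 0 by omega, h0, infDist_zero_of_mem ha] at this
    linarith
  have hik : ∀ n, i n < k n := by
    intro n
    refine lt_of_le_of_ne (hi n) fun hcon => ?_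
    have := hfar n
    rw [hcon, h1, infDist_zero_of_mem hb] at this
    linarith
  have haz : ChainReach f a z := by
    refine chainReach_of_approx_right fun r hr => ?_
    obtain ⟨n, hn1, hn2⟩ := happrox r hr
    exact ⟨c n (i n), i n, hn1, hi0 n, c n, h0 n, rfl, fun _ _ => mem_univ _,
      fun j hj => (hd n j (hj.trans (hik n))).trans hn2⟩
  have hzb : ChainReach f z b := by
    refine chainReach_of_approx_left hf fun r hr => ?_
    obtain ⟨n, hn1, hn2⟩ := happrox r hr
    have hin := hik n
    refine ⟨c n (i n), k n - i n, hn1, by omega, fun j => c n (i n + j), rfl, ?_,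
      fun _ _ => mem_univ _, fun j hj => (hd n (i n + j) (by omega)).trans hn2⟩
    simp only [Nat.add_sub_cancel' (hi n), h1]
  have hzC : z ∈ C := (hC.mem_iff ha).2 ⟨haz, hzb.trans ((hC.mem_iff hb).1 ha).1⟩
  rw [infDist_zero_of_mem hzC] at hzfar
  linarith

/-- A chain component is internally chain transitive. -/
lemma IsChainComponent.exists_chainIn [CompactSpace X] (hC : IsChainComponent f C)
    (hf : Continuous f) {a b : X} (ha : a ∈ C) (hb : b ∈ C) {δ : ℝ} (hδ : 0 < δ) :
    ∃ k, ChainIn f C δ k a b := by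
  obtain ⟨ρ, hρ, Hρ⟩ := exists_dist_map_le_of_continuous hf (show 0 < δ / 3 by positivity)
  obtain ⟨η, hη, Hη⟩ := hC.exists_chain_near hf ha hb (show 0 < min ρ (δ / 3) by positivity)
  obtain ⟨k, hk, c, h0, h1, -, hd⟩ := ((hC.mem_iff ha).1 hb).1 (min η (δ / 3)) (by positivity)
  have hnear : ∀ i, ∃ p, i ≤ k → p ∈ C ∧ dist (c i) p ≤ min ρ (δ / 3) ∧
      (c i ∈ C → p = c i) := by
    intro i
    by_cases hiC : c i ∈ C
    · exact ⟨c i, fun _ => ⟨hiC, by rw [dist_self]; positivity, fun _ => rfl⟩⟩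
    by_cases hi : i ≤ k
    · obtain ⟨p, hp, hpd⟩ := (infDist_lt_iff hC.nonempty).1
        (Hη k c h0 h1 (fun i hi => (hd i hi).trans (min_le_left _ _)) i hi)
      exact ⟨p, fun _ => ⟨hp, hpd.le, fun h => absurd h hiC⟩⟩
    · exact ⟨c i, fun h => absurd h hi⟩
  choose p hp using hnear
  refine ⟨k, hk, p, ?_, ?_, fun i hi => (hp i hi).1, fun i hi => ?_⟩
  · rw [(hp 0 (by omega)).2.2 (h0 ▸ ha), h0]
  · rw [(hp k le_rfl).2.2 (h1 ▸ hb), h1]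
  · have e1 := Hρ (p i) (c i) (by
      rw [dist_comm]; exact (hp i hi.le).2.1.trans (min_le_left _ _))
    have e2 := (hd i hi).trans (min_le_right _ _)
    have e3 := (hp (i + 1) hi).2.1.trans (min_le_right _ _)
    linarith [dist_triangle4 (f (p i)) (f (c i)) (c (i + 1)) (p (i + 1))]

end ChainComponents

lemma setGcd_eq_nat_setGcd (S : Set ℕ) : setGcd S = Nat.setGcd S := by
  have hS : {d | ∀ k ∈ S, d ∣ k} = {d | d ∣ Nat.setGcd S} := by
    ext d
    exact Nat.dvd_setGcd_iff.symm
  rw [setGcd, hS]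
  rcases Nat.eq_zero_or_pos (Nat.setGcd S) with h0 | hpos
  · rw [h0]
    refine Nat.sSup_of_not_bddAbove ?_
    simp
  · exact IsGreatest.csSup_eq ⟨dvd_rfl, fun d hd => Nat.le_of_dvd hpos hd⟩

section Phase

variable {X : Type*} [MetricSpace X] {f : X → X} {C : Set X}

lemma setGcd_dvd_length {δ : ℝ} {k : ℕ} {x : X} (h : ChainIn f C δ k x x) :
    setGcd (cycleLengths f C δ) ∣ k := by
  rw [setGcd_eq_nat_setGcd]
  exact Nat.setGcd_dvd_of_mem ⟨x, h.left_mem, h⟩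

lemma setGcd_dvd_setGcd {S T : Set ℕ} (h : S ⊆ T) : setGcd T ∣ setGcd S := by
  simpa only [setGcd_eq_nat_setGcd] using Nat.setGcd_mono h

lemma SimCd.trans {δ : ℝ} {x y z : X} (h : SimCd f C δ x y) (h' : SimCd f C δ y z) :
    SimCd f C δ x z := by
  obtain ⟨k, hk, hc⟩ := h
  obtain ⟨l, hl, hc'⟩ := h'
  exact ⟨k + l, dvd_add hk hl, hc.trans hc'⟩

lemma SimCd.mono {δ δ' : ℝ} {x y : X} (h : SimCd f C δ x y) (hδ : δ ≤ δ') :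
    SimCd f C δ' x y := by
  obtain ⟨k, hk, hc⟩ := h
  refine ⟨k, (setGcd_dvd_setGcd ?_).trans hk, hc.mono subset_rfl hδ⟩
  rintro l ⟨x, hx, hl⟩
  exact ⟨x, hx, hl.mono subset_rfl hδ⟩

lemma IsChainComponent.simCd_refl [CompactSpace X] (hC : IsChainComponent f C)
    (hf : Continuous f) {a : X} (ha : a ∈ C) {δ : ℝ} (hδ : 0 < δ) : SimCd f C δ a a := by
  obtain ⟨k, hk⟩ := hC.exists_chainIn hf ha ha hδ
  exact ⟨k, setGcd_dvd_length hk, hk⟩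

/-- Every sufficiently large multiple of the gcd of all cycle lengths is the length of a cycle
through a prescribed point. -/
lemma exists_chainIn_of_dvd {δ : ℝ} (htr : ∀ a ∈ C, ∀ b ∈ C, ∃ k, ChainIn f C δ k a b)
    {w : X} (hw : w ∈ C) :
    ∃ K, ∀ t ≥ K, setGcd (cycleLengths f C δ) ∣ t → ChainIn f C δ t w w := by
  set S : Set ℕ := {k | ChainIn f C δ k w w}
  have hdvd : Nat.setGcd S ∣ setGcd (cycleLengths f C δ) := by
    rw [setGcd_eq_nat_setGcd]
    refine Nat.dvd_setGcd_iff.2 ?_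
    rintro k ⟨v, hv, hk⟩
    obtain ⟨l, hl⟩ := htr w hw v hv
    obtain ⟨l', hl'⟩ := htr v hv w hw
    have e1 : Nat.setGcd S ∣ l + l' := Nat.setGcd_dvd_of_mem (hl.trans hl')
    have e2 : Nat.setGcd S ∣ l + k + l' := Nat.setGcd_dvd_of_mem ((hl.trans hk).trans hl')
    rw [show l + k + l' = (l + l') + k by ring] at e2
    exact (Nat.dvd_add_right e1).1 e2
  obtain ⟨K, hK⟩ := Nat.exists_mem_closure_of_ge (s := S)
  have hmem : ∀ t ∈ AddSubmonoid.closure S, t = 0 ∨ t ∈ S := by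
    intro t ht
    induction ht using AddSubmonoid.closure_induction with
    | mem x hx => exact Or.inr hx
    | zero => exact Or.inl rfl
    | add x y _ _ hx hy =>
      rcases hx with rfl | hx
      · simpa using hy
      rcases hy with rfl | hy
      · exact Or.inr hx
      exact Or.inr (ChainIn.trans hx hy)
  refine ⟨max K 1, fun t ht hdt => ?_⟩
  rcases hmem t (hK t ((le_max_left _ _).trans ht) (hdvd.trans hdt)) with h0 | h
  · have := (le_max_right K 1).trans ht
    omega
  · exact h

/-- The sequence `e` is asymptotically in phase with the class of `a` in `𝒟(C)`. -/
def InPhase (f : X → X) (C : Set X) (a : X) (e : ℕ → X) : Prop :=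
  ∀ η > 0, ∀ᶠ N in atTop, ∃ p ∈ C, SimCd f C η a p ∧ dist (e N) (f^[N] p) ≤ η

lemma InPhase.congr {a : X} {e e' : ℕ → X} (h : InPhase f C a e)
    (hee : Tendsto (fun i => dist (e i) (e' i)) atTop (𝓝 0)) : InPhase f C a e' := by
  intro η hη
  filter_upwards [h (η / 2) (by positivity), hee.eventually (gt_mem_nhds (half_pos hη))]
    with N ⟨p, hp, hap, hd⟩ hN
  refine ⟨p, hp, hap.mono (by linarith), ?_⟩
  rw [dist_comm] at hN
  linarith [dist_triangle (e' N) (e N) (f^[N] p)]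

lemma IsChainComponent.mem_vStable_iff [CompactSpace X] (hC : IsChainComponent f C)
    (hf : Continuous f) {a x : X} (haC : a ∈ C) {E : Set X} (ha : a ∈ E)
    (hE : E ⊆ {y ∈ C | SimC f C a y}) :
    x ∈ vStable f C E ↔ InPhase f C a (fun i => f^[i] x) := by
  have hmaps := hC.mapsTo hf
  constructor
  · rintro ⟨-, hx⟩ η hη
    have hlim := hx η hη {y ∈ C | SimCd f C η a y} ⟨a, haC, rfl⟩
      fun y hy => ⟨(hE hy).1, (hE hy).2 η hη⟩
    filter_upwards [hlim.eventually (gt_mem_nhds hη)] with N hN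
    have hne : {y ∈ C | SimCd f C η a y}.Nonempty := ⟨a, haC, hC.simCd_refl hf haC hη⟩
    obtain ⟨-, ⟨p, ⟨hp, hap⟩, rfl⟩, hd⟩ := (infDist_lt_iff (hne.image _)).1 hN
    exact ⟨p, hp, hap, hd.le⟩
  · intro hx
    refine ⟨Metric.tendsto_nhds.2 fun ε hε => ?_, fun δ hδ Dd hDd hEDd =>
      Metric.tendsto_nhds.2 fun ε hε => ?_⟩
    · filter_upwards [hx (ε / 2) (by positivity)] with N hN
      obtain ⟨p, hp, -, hd⟩ := hN
      rw [Real.dist_0_eq_abs, abs_of_nonneg infDist_nonneg]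
      linarith [infDist_le_dist_of_mem (x := f^[N] x) (hmaps.iterate N hp)]
    · obtain ⟨b, hb, rfl⟩ := hDd
      filter_upwards [hx (min δ (ε / 2)) (by positivity)] with N ⟨p, hp, hap, hd⟩
      have hmem : p ∈ {y ∈ C | SimCd f C δ b y} :=
        ⟨hp, (hEDd ha).2.trans (hap.mono (min_le_left _ _))⟩
      rw [Real.dist_0_eq_abs, abs_of_nonneg infDist_nonneg]
      linarith [infDist_le_dist_of_mem (x := f^[N] x) (mem_image_of_mem (f^[N]) hmem),
        min_le_right δ (ε / 2)]

/-- Two sequences in phase with the same class can be joined by chains whose length is the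
exact difference of the times. -/
lemma InPhase.exists_chainIn [CompactSpace X] (hmaps : MapsTo f C C)
    {η : ℝ} (hη : 0 < η) (htr : ∀ a ∈ C, ∀ b ∈ C, ∃ k, ChainIn f C η k a b)
    {a p : X} {e : ℕ → X} (he : ∀ i, e i ∈ C) (hphase : InPhase f C a e)
    (hp : p ∈ C) (hap : SimCd f C η a p) {N : ℕ} (hN : 1 ≤ N) {P : ℕ → Prop}
    (hP : ∀ᶠ M in atTop, P M) :
    ∃ M, P M ∧ N < M ∧ ChainIn f C (2 * η) (M - N) (f^[N] p) (e M) := by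
  set m := setGcd (cycleLengths f C η) with hm
  have hm1 : 1 ≤ m := by
    obtain ⟨k, hk⟩ := htr p hp p hp
    have hk1 := hk.1
    exact Nat.pos_of_dvd_of_pos (setGcd_dvd_length hk) hk1
  obtain ⟨w₀, φ, hφ, hw₀⟩ := CompactSpace.tendsto_subseq (fun r => e (m * r))
  have hmφ : Tendsto (fun r => m * φ r) atTop atTop :=
    tendsto_atTop_mono (fun r => Nat.le_mul_of_pos_left _ hm1) hφ.tendsto_atTop
  have hclose := Metric.tendsto_nhds.1 hw₀ (η / 4) (by positivity)
  obtain ⟨r₀, ⟨hr₀, q, hq, haq, hdq⟩, hr₀1⟩ := ((hclose.and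
    (hmφ.eventually (hphase (η / 2) (by positivity)))).and
    (hmφ.eventually (eventually_ge_atTop 1))).exists
  set w := e (m * φ r₀)
  have hw : w ∈ C := he _
  obtain ⟨s, hs⟩ := htr w hw a hap.choose_spec.2.left_mem
  obtain ⟨l, hl⟩ := htr (f^[N] p) (hmaps.iterate N hp) w hw
  obtain ⟨K, hK⟩ := exists_chainIn_of_dvd htr hw
  have hs_dvd : m ∣ s := by
    obtain ⟨k, hk, hc⟩ := haq.mono (show η / 2 ≤ η by linarith)
    have hqw : ChainIn f C η (m * φ r₀) q w :=
      ((ChainIn.orbit hmaps hq hr₀1).change_right hw (δ' := η / 2)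
        (by rw [dist_comm]; exact hdq)).mono subset_rfl (by linarith)
    have := setGcd_dvd_length ((hc.trans hqw).trans hs)
    exact (Nat.dvd_add_right (dvd_add hk (dvd_mul_right _ _))).1 this
  have hNl : m ∣ N + l := by
    obtain ⟨k, hk, hc⟩ := hap
    have horb := (ChainIn.orbit hmaps hp hN).mono subset_rfl hη.le
    have := setGcd_dvd_length (((hc.trans horb).trans hl).trans hs)
    rw [add_assoc k N l] at this
    exact (Nat.dvd_add_right hk).1 ((Nat.dvd_add_left hs_dvd).1 this)
  obtain ⟨r, ⟨hr, hPr⟩, hrK⟩ := ((hclose.and (hmφ.eventually hP)).and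
    (hmφ.eventually (eventually_ge_atTop (N + l + K)))).exists
  have hl1 : 1 ≤ l := hl.1
  refine ⟨m * φ r, hPr, by omega, ?_⟩
  have hcyc := hK (m * φ r - (N + l)) (by omega) (Nat.dvd_sub (dvd_mul_right _ _) hNl)
  have hchain := hl.trans hcyc
  rw [show l + (m * φ r - (N + l)) = m * φ r - N by omega] at hchain
  refine (hchain.change_right (he _) (δ' := η) ?_).mono subset_rfl (by linarith)
  have h1 : dist w w₀ < η / 4 := hr₀
  have h2 : dist (e (m * φ r)) w₀ < η / 4 := hr
  linarith [dist_triangle_right w (e (m * φ r)) w₀]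

/-- Under s-limit shadowing, a limit pseudo-orbit in a chain component is asymptotically
shadowed by a point close to any given point in phase with it. -/
lemma IsChainComponent.exists_asymptotic_point [CompactSpace X] (hC : IsChainComponent f C)
    (hf : Continuous f) (hsls : SLimitShadowing f) {a y : X} {e : ℕ → X} (he : ∀ i, e i ∈ C)
    (hpseudo : Tendsto (fun i => dist (f (e i)) (e (i + 1))) atTop (𝓝 0))
    (hphase : InPhase f C a e) (hy : InPhase f C a (fun i => f^[i] y)) {ε : ℝ} (hε : 0 < ε) :
    ∃ z, dist z y ≤ ε ∧ Tendsto (fun i => dist (f^[i] z) (e i)) atTop (𝓝 0) := by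
  obtain ⟨δ, hδ, H⟩ := hsls ε hε
  have hη : 0 < δ / 2 := half_pos hδ
  obtain ⟨N, ⟨p, hp, hap, hd⟩, hN⟩ := ((hy (δ / 2) hη).and (eventually_ge_atTop 1)).exists
  have hPs : ∀ᶠ M in atTop, ∀ i ≥ M, dist (f (e i)) (e (i + 1)) ≤ δ :=
    eventually_forall_ge_atTop.2
      ((hpseudo.eventually (gt_mem_nhds hδ)).mono fun i hi => hi.le)
  obtain ⟨M, hM, hNM, -, c, c0, c1, -, hc⟩ := hphase.exists_chainIn (hC.mapsTo hf) hη
    (fun a ha b hb => hC.exists_chainIn hf ha hb hη) he hp hap hN hPs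
  rw [mul_div_cancel₀ _ two_ne_zero] at hc
  set u : ℕ → X := fun i => if i < N then f^[i] y else if i < M then c (i - N) else e i
  have hu_tail : ∀ i ≥ M, u i = e i := fun i hi => by
    simp only [u]
    rw [if_neg (by omega), if_neg (by omega)]
  have hu : ∀ i, dist (f (u i)) (u (i + 1)) ≤ δ := by
    intro i
    rcases lt_or_ge i N with hi | hi
    · have hui : f (u i) = f^[i + 1] y := by
        simp only [u, if_pos hi, Function.iterate_succ_apply']
      rw [hui]
      rcases eq_or_lt_of_le (Nat.succ_le_of_lt hi) with h2 | h2
      · have : u (i + 1) = f^[N] p := by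
          simp only [u]
          rw [if_neg (by omega), if_pos (by omega), show i + 1 - N = 0 by omega, c0]
        rw [this, show i + 1 = N by omega]
        linarith
      · simp only [u, if_pos h2, dist_self]
        exact hδ.le
    rcases lt_or_ge i M with hi' | hi'
    · have hui : u i = c (i - N) := by
        simp only [u]
        rw [if_neg (by omega), if_pos hi']
      have hui' : u (i + 1) = c (i - N + 1) := by
        rcases eq_or_lt_of_le (Nat.succ_le_of_lt hi') with h2 | h2
        · rw [hu_tail (i + 1) (by omega), show i - N + 1 = M - N by omega, c1,
            show i + 1 = M by omega]
        · simp only [u]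
          rw [if_neg (by omega), if_pos h2, show i + 1 - N = i - N + 1 by omega]
      rw [hui, hui']
      exact hc _ (by omega)
    · rw [hu_tail i hi', hu_tail (i + 1) (by omega)]
      exact hM i hi'
  obtain ⟨z, hz, hzlim⟩ := H u hu (hpseudo.congr' (by
    filter_upwards [eventually_ge_atTop M] with i hi
    rw [hu_tail i hi, hu_tail (i + 1) (by omega)]))
  refine ⟨z, ?_, hzlim.congr' ?_⟩
  · have hu0 : u 0 = y := by
      simp only [u]
      rw [if_pos (by omega), Function.iterate_zero_apply]
    simpa [hu0] using hz 0
  · filter_upwards [eventually_ge_atTop M] with i hi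
    rw [hu_tail i hi]

lemma IsChainComponent.exists_pseudo_orbit [CompactSpace X] (hC : IsChainComponent f C)
    (hf : Continuous f) {x : X} (hx : x ∈ wStable f C) :
    ∃ c : ℕ → X, (∀ i, c i ∈ C) ∧ Tendsto (fun i => dist (f^[i] x) (c i)) atTop (𝓝 0) ∧
      Tendsto (fun i => dist (f (c i)) (c (i + 1))) atTop (𝓝 0) := by
  choose c hcC hc using fun i : ℕ =>
    (hC.isClosed hf).isCompact.exists_infDist_eq_dist hC.nonempty (f^[i] x)
  have hlim : Tendsto (fun i => dist (f^[i] x) (c i)) atTop (𝓝 0) := by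
    simp only [← hc]
    exact hx
  refine ⟨c, hcC, hlim, Metric.tendsto_nhds.2 fun ε hε => ?_⟩
  obtain ⟨ρ, hρ, Hρ⟩ := exists_dist_map_le_of_continuous hf (show 0 < ε / 3 by positivity)
  filter_upwards [hlim.eventually (gt_mem_nhds hρ), (hlim.comp (tendsto_add_atTop_nat 1)).eventually
    (gt_mem_nhds (show 0 < ε / 3 by positivity))] with i h1 h2
  rw [Real.dist_0_eq_abs, abs_of_nonneg dist_nonneg]
  have e1 := Hρ _ _ h1.le
  rw [← Function.iterate_succ_apply' f, dist_comm] at e1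
  have e2 : dist (f^[i + 1] x) (c (i + 1)) < ε / 3 := h2
  linarith [dist_triangle (f (c i)) (f^[i + 1] x) (c (i + 1))]

end Phase

section Conjugacy

variable {X Y : Type*} [MetricSpace X] [MetricSpace Y] {f : X → X} {g : Y → Y} {h : X → Y}
  {C : Set X} {C' : Set Y}

lemma ChainIn.map (hf : MapsTo f C C) (hmaps : MapsTo h C C') (hconj : ∀ x ∈ C, h (f x) = g (h x))
    {ρ η : ℝ} (H : ∀ x ∈ C, ∀ y ∈ C, dist x y ≤ ρ → dist (h x) (h y) ≤ η) {k : ℕ} {x y : X}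
    (hc : ChainIn f C ρ k x y) : ChainIn g C' η k (h x) (h y) := by
  obtain ⟨hk, c, h0, h1, hcC, hd⟩ := hc
  refine ⟨hk, h ∘ c, congrArg h h0, congrArg h h1, fun i hi => hmaps (hcC i hi), fun i hi => ?_⟩
  simp only [Function.comp_apply]
  rw [← hconj _ (hcC i hi.le)]
  exact H _ (hf (hcC i hi.le)) _ (hcC _ hi) (hd i hi)

lemma SimCd.map (hf : MapsTo f C C) (hmaps : MapsTo h C C') (hconj : ∀ x ∈ C, h (f x) = g (h x))
    {ρ η : ℝ} (H : ∀ x ∈ C, ∀ y ∈ C, dist x y ≤ ρ → dist (h x) (h y) ≤ η) {x y : X}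
    (hc : SimCd f C ρ x y) : SimCd g C' η (h x) (h y) := by
  obtain ⟨k, hk, hc⟩ := hc
  refine ⟨k, (setGcd_dvd_setGcd ?_).trans hk, hc.map hf hmaps hconj H⟩
  rintro l ⟨z, hz, hl⟩
  exact ⟨h z, hmaps hz, hl.map hf hmaps hconj H⟩

lemma InPhase.map (hf : MapsTo f C C) (hmaps : MapsTo h C C')
    (hconj : ∀ x ∈ C, h (f x) = g (h x))
    (H : ∀ η > 0, ∃ ρ > 0, ∀ x ∈ C, ∀ y ∈ C, dist x y ≤ ρ → dist (h x) (h y) ≤ η)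
    {a : X} {e : ℕ → X} (he : ∀ i, e i ∈ C) (hphase : InPhase f C a e) :
    InPhase g C' (h a) (fun i => h (e i)) := by
  intro η hη
  obtain ⟨ρ, hρ, H⟩ := H η hη
  filter_upwards [hphase ρ hρ] with N ⟨p, hp, hap, hd⟩
  refine ⟨h p, hmaps hp, hap.map hf hmaps hconj H, ?_⟩
  have hiter : ∀ i, h (f^[i] p) = g^[i] (h p) := by
    intro i
    induction i with
    | zero => rfl
    | succ i ih =>
      rw [Function.iterate_succ_apply', Function.iterate_succ_apply',
        hconj _ (hf.iterate i hp), ih]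
  rw [← hiter]
  exact H _ (he N) _ (hf.iterate N hp) hd

lemma IsCompact.exists_le_dist_map (hC : IsCompact C) (hcont : ContinuousOn h C)
    (hinj : InjOn h C) {r : ℝ} (hr : 0 < r) :
    ∃ κ > 0, ∀ x ∈ C, ∀ y ∈ C, r ≤ dist x y → κ ≤ dist (h x) (h y) := by
  have hK : IsCompact ((C ×ˢ C) ∩ {q : X × X | r ≤ dist q.1 q.2}) :=
    (hC.prod hC).inter_right (isClosed_le continuous_const continuous_dist)
  have hcd : ContinuousOn (fun q : X × X => dist (h q.1) (h q.2))
      ((C ×ˢ C) ∩ {q : X × X | r ≤ dist q.1 q.2}) :=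
    continuous_dist.comp_continuousOn <|
      (hcont.comp continuousOn_fst fun q hq => hq.1.1).prodMk
        (hcont.comp continuousOn_snd fun q hq => hq.1.2)
  obtain ⟨κ, hκ, H⟩ := hK.exists_forall_le' hcd (a := 0) fun q hq => by
    refine dist_pos.2 fun heq => ?_
    have hqr : r ≤ dist q.1 q.2 := hq.2
    rw [hinj hq.1.1 hq.1.2 heq, dist_self] at hqr
    linarith
  exact ⟨κ, hκ, fun x hx y hy hxy => H (x, y) ⟨⟨hx, hy⟩, hxy⟩⟩

end Conjugacy

/-- Corollary 1.1: dense `(ℱ,𝒢)`-n-δ-chaos transfers through a topological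
conjugacy `h : (C, f|_C) → (C', g|_{C'})`, assuming `g` has the s-limit shadowing property. -/
theorem dense_chaos_transfer_of_conjugacy
    {X Y : Type*} [MetricSpace X] [CompactSpace X] [MetricSpace Y] [CompactSpace Y]
    (f : X → X) (g : Y → Y) (hf : Continuous f) (hg : Continuous g)
    (C : Set X) (hC : IsChainComponent f C) (D : Set X) (hD : D ∈ DClasses f C)
    (C' : Set Y) (hC' : IsChainComponent g C')
    (h : X → Y) (hcont : ContinuousOn h C) (hinj : Set.InjOn h C) (himg : h '' C = C')
    (hconj : ∀ x ∈ C, h (f x) = g (h x))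
    (F G : Set (Set ℕ)) (hF : FurstenbergFamily F) (hFfull : FullFamily F)
    (hG : FurstenbergFamily G) (hGfull : FullFamily G)
    (n : ℕ) (hn : 2 ≤ n) (δ : ℝ) (hδ : 0 < δ)
    (hsls : SLimitShadowing g)
    (hchaos : DenseChaotic f F G n δ (vStable f C D)) :
    ∃ δ' > 0, DenseChaotic g F G n δ' (vStable g C' (h '' D)) := by
  obtain ⟨a, haC, rfl⟩ := hD
  have haD : a ∈ {y ∈ C | SimC f C a y} := ⟨haC, fun η hη => hC.simCd_refl hf haC hη⟩
  have hmapsf := hC.mapsTo hf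
  have hCcpt : IsCompact C := (hC.isClosed hf).isCompact
  have hmaps : MapsTo h C C' := fun x hx => himg ▸ mem_image_of_mem h hx
  have huc : ∀ η > 0, ∃ ρ > 0, ∀ x ∈ C, ∀ y ∈ C, dist x y ≤ ρ → dist (h x) (h y) ≤ η := by
    intro η hη
    obtain ⟨ρ, hρ, H⟩ := Metric.uniformContinuousOn_iff.1
      (hCcpt.uniformContinuousOn_of_continuous hcont) η hη
    exact ⟨ρ / 2, by positivity, fun x hx y hy hxy => (H x hx y hy (by linarith)).le⟩
  have himgD : h '' {y ∈ C | SimC f C a y} ⊆ {y ∈ C' | SimC g C' (h a) y} := by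
    rintro _ ⟨y, ⟨hy, hay⟩, rfl⟩
    refine ⟨hmaps hy, fun η hη => ?_⟩
    obtain ⟨ρ, hρ, H⟩ := huc η hη
    exact (hay ρ hρ).map hmapsf hmaps hconj H
  obtain ⟨κ, hκ, hsep⟩ := hCcpt.exists_le_dist_map hcont hinj (half_pos hδ)
  obtain ⟨x, hx, hxF, hxG⟩ : {x : Fin n → X | (∀ j, x j ∈ vStable f C {y ∈ C | SimC f C a y}) ∧
      Scrambled f F G δ x}.Nonempty := by
    refine closure_nonempty_iff.1 ⟨fun _ => a, hchaos fun _ => ?_⟩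
    refine (hC.mem_vStable_iff hf haC haD subset_rfl).2 fun η hη => Eventually.of_forall fun N => ?_
    exact ⟨a, haC, hC.simCd_refl hf haC hη, by rw [dist_self]; exact hη.le⟩
  choose c hcC hclim hcpseudo using fun j => hC.exists_pseudo_orbit hf (hx j).1
  have hcphase : ∀ j, InPhase g C' (h a) (fun i => h (c j i)) := fun j =>
    (((hC.mem_vStable_iff hf haC haD subset_rfl).1 (hx j)).congr (hclim j)).map
      hmapsf hmaps hconj huc (hcC j)
  have hhpseudo : ∀ j, Tendsto (fun i => dist (g (h (c j i))) (h (c j (i + 1)))) atTop (𝓝 0) := by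
    intro j
    refine Metric.tendsto_nhds.2 fun ε hε => ?_
    obtain ⟨ρ, hρ, H⟩ := huc (ε / 2) (by positivity)
    filter_upwards [(hcpseudo j).eventually (gt_mem_nhds hρ)] with i hi
    rw [Real.dist_0_eq_abs, abs_of_nonneg dist_nonneg, ← hconj _ (hcC j i)]
    linarith [H _ (hmapsf (hcC j i)) _ (hcC j (i + 1)) hi.le]
  refine ⟨κ / 2, by positivity, fun y hy => Metric.mem_closure_iff.2 fun ε hε => ?_⟩
  have haD' : h a ∈ h '' {y ∈ C | SimC f C a y} := mem_image_of_mem h haD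
  choose z hzy hz using fun j => hC'.exists_asymptotic_point hg hsls
    (fun i => hmaps (hcC j i)) (hhpseudo j) (hcphase j)
    ((hC'.mem_vStable_iff hg (hmaps haC) haD' himgD).1 (hy j)) (half_pos hε)
  have hclose : ∀ r > 0, ∃ N, ∀ i ≥ N, ∀ j, dist (f^[i] (x j)) (c j i) < r ∧
      dist (g^[i] (z j)) (h (c j i)) < r := fun r hr => eventually_atTop.1 <|
    eventually_all.2 fun j => ((hclim j).eventually (gt_mem_nhds hr)).and
      ((hz j).eventually (gt_mem_nhds hr))
  refine ⟨z, ⟨fun j => ?_, ?_, fun r hr => ?_⟩, ?_⟩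
  · refine (hC'.mem_vStable_iff hg (hmaps haC) haD' himgD).2 ((hcphase j).congr ?_)
    simpa only [dist_comm] using hz j
  · obtain ⟨N, hN⟩ := hclose (min (δ / 4) (κ / 4)) (by positivity)
    refine hF.1 _ _ (hFfull _ hxF N) ?_
    rintro i ⟨hi, hNi⟩ j k hjk
    obtain ⟨e1, e2⟩ := hN i hNi j
    obtain ⟨e3, e4⟩ := hN i hNi k
    have m1 := min_le_left (δ / 4) (κ / 4)
    have m2 := min_le_right (δ / 4) (κ / 4)
    have h1 := hi j k hjk
    have h2 := dist_triangle4_right (f^[i] (x j)) (f^[i] (x k)) (c j i) (c k i)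
    have h3 := hsep _ (hcC j i) _ (hcC k i) (by linarith)
    rw [dist_comm] at e2 e4
    have h4 := dist_triangle4_right (h (c j i)) (h (c k i)) (g^[i] (z j)) (g^[i] (z k))
    linarith
  · obtain ⟨ρ, hρ, H⟩ := huc (r / 4) (by positivity)
    obtain ⟨N, hN⟩ := hclose (min (ρ / 4) (r / 4)) (by positivity)
    refine hG.1 _ _ (hGfull _ (hxG (ρ / 4) (by positivity)) N) ?_
    rintro i ⟨hi, hNi⟩ j k hjk
    obtain ⟨e1, e2⟩ := hN i hNi j
    obtain ⟨e3, e4⟩ := hN i hNi k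
    have m1 := min_le_left (ρ / 4) (r / 4)
    have m2 := min_le_right (ρ / 4) (r / 4)
    have h1 := hi j k hjk
    rw [dist_comm] at e1 e3
    have h2 := dist_triangle4_right (c j i) (c k i) (f^[i] (x j)) (f^[i] (x k))
    have h3 := H _ (hcC j i) _ (hcC k i) (by linarith)
    have h4 := dist_triangle4_right (g^[i] (z j)) (g^[i] (z k)) (h (c j i)) (h (c k i))
    linarith
  · refine (dist_pi_lt_iff hε).2 fun j => ?_
    rw [dist_comm]
    linarith [hzy j]
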